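/- Let $\alpha\in(-\infty,1)$ and $p\in(1,\infty)$. The power weight $\omega_1(x)=x_d^\beta$ on $\mathbb{R}^d_+$ belongs to the Muckenhoupt class $A_p(\mathbb{R}^d_+,\mu_1)$ with respect to the measure $\mu_1(dx)=x_d^{-\alpha}dx$ if and only if $\beta\in(\alpha-1,\ (1-\alpha)(p-1))$. -/

import Mathlib

open MeasureTheory Real Set ENNReal

noncomputable section

/-- The upper half ball `B_r^+(x0)` in `ℝ^{n} × ℝ`. -/
def upperHalfBall (n : ℕ) (r : ℝ) (x0 : EuclideanSpace ℝ (Fin n) × ℝ) :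
    Set (EuclideanSpace ℝ (Fin n) × ℝ) :=
  {y | 0 < y.2 ∧ ‖y.1 - x0.1‖ ^ 2 + (y.2 - x0.2) ^ 2 < r ^ 2}

lemma measurableSet_upperHalfBall (n : ℕ) (r : ℝ) (x0 : EuclideanSpace ℝ (Fin n) × ℝ) :
    MeasurableSet (upperHalfBall n r x0) := by
  have h₁ : IsOpen {y : EuclideanSpace ℝ (Fin n) × ℝ | 0 < y.2} :=
    isOpen_lt continuous_const continuous_snd
  have h₂ : IsOpen {y : EuclideanSpace ℝ (Fin n) × ℝ |
      ‖y.1 - x0.1‖ ^ 2 + (y.2 - x0.2) ^ 2 < r ^ 2} :=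
    isOpen_lt (by fun_prop) continuous_const
  exact (h₁.inter h₂).measurableSet

lemma lintegral_ball_prod_snd (n : ℕ) (x : EuclideanSpace ℝ (Fin n)) {r : ℝ} (hr : 0 < r)
    (J : Set ℝ) {f : ℝ → ℝ≥0∞} (hf : Measurable f) :
    ∫⁻ y in Metric.ball x r ×ˢ J, f y.2 =
      ENNReal.ofReal (r ^ n * volume.real (Metric.ball (0 : EuclideanSpace ℝ (Fin n)) 1)) *
        ∫⁻ t in J, f t := by
  rw [Measure.volume_eq_prod, setLIntegral_prod (fun y => f y.2) (hf.comp measurable_snd).aemeasurable]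
  dsimp only
  rw [lintegral_const, Measure.restrict_apply_univ, mul_comm, Measure.addHaar_ball_of_pos _ _ hr,
    finrank_euclideanSpace_fin, ENNReal.ofReal_mul (by positivity),
    ofReal_measureReal measure_ball_lt_top.ne]

lemma volumeReal_unit_ball_pos (n : ℕ) :
    0 < volume.real (Metric.ball (0 : EuclideanSpace ℝ (Fin n)) 1) :=
  ENNReal.toReal_pos (Metric.measure_ball_pos _ _ one_pos).ne' measure_ball_lt_top.ne

lemma rpow_le_mul_rpow_of_comparable {y ρ : ℝ} (s : ℝ) (hρ : 0 < ρ) (h₁ : ρ / 4 ≤ y)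
    (h₂ : y ≤ 4 * ρ) : y ^ s ≤ 4 ^ |s| * ρ ^ s := by
  have hy : 0 < y := by linarith
  rcases le_total 0 s with hs | hs
  · rw [abs_of_nonneg hs, ← Real.mul_rpow (by norm_num) hρ.le]
    exact Real.rpow_le_rpow hy.le h₂ hs
  · rw [abs_of_nonpos hs, Real.rpow_neg (by norm_num), ← Real.inv_rpow (by norm_num),
      ← Real.mul_rpow (by norm_num) hρ.le]
    exact Real.rpow_le_rpow_of_nonpos (by positivity) (by linarith) hs

lemma ofReal_mul_le_lintegral_upperHalfBall (n : ℕ) (s : ℝ) {r : ℝ} (hr : 0 < r)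
    (x0 : EuclideanSpace ℝ (Fin n) × ℝ) (hx : 0 ≤ x0.2) :
    ENNReal.ofReal ((2⁻¹ ^ n * 4⁻¹ * (4 ^ |s|)⁻¹) *
        (volume.real (Metric.ball (0 : EuclideanSpace ℝ (Fin n)) 1) * r ^ (n + 1)) *
        max x0.2 r ^ s) ≤
      ∫⁻ y in upperHalfBall n r x0, ENNReal.ofReal (y.2 ^ s) := by
  set ρ := max x0.2 r
  have hρ : 0 < ρ := lt_max_of_lt_right hr
  have hsub : Metric.ball x0.1 (r / 2) ×ˢ Set.Ioo (x0.2 + r / 4) (x0.2 + r / 2) ⊆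
      upperHalfBall n r x0 := by
    rintro ⟨a, t⟩ ⟨ha, ht⟩
    simp only [mem_ball_iff_norm, Set.mem_Ioo] at ha ht
    refine ⟨by dsimp only; linarith [ht.1], ?_⟩
    dsimp only
    nlinarith [norm_nonneg (a - x0.1)]
  refine le_trans ?_ (lintegral_mono_set hsub)
  rw [lintegral_ball_prod_snd n x0.1 (half_pos hr) _
    (f := fun t => ENNReal.ofReal (t ^ s)) (by fun_prop)]
  have hJ : ENNReal.ofReal ((4 ^ |s|)⁻¹ * ρ ^ s * (r / 4)) ≤
      ∫⁻ t in Set.Ioo (x0.2 + r / 4) (x0.2 + r / 2), ENNReal.ofReal (t ^ s) := by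
    calc _ = ∫⁻ t in Set.Ioo (x0.2 + r / 4) (x0.2 + r / 2),
          ENNReal.ofReal ((4 ^ |s|)⁻¹ * ρ ^ s) := by
          rw [setLIntegral_const, Real.volume_Ioo, ← ENNReal.ofReal_mul (by positivity)]
          congr 2; ring
      _ ≤ _ := by
          refine setLIntegral_mono' measurableSet_Ioo fun t ht => ENNReal.ofReal_le_ofReal ?_
          have ht0 : 0 < t := by linarith [ht.1]
          have h₁ : ρ ≤ 4 * t := max_le (by linarith [ht.1]) (by linarith [ht.1])
          have h₂ : t ≤ 2 * ρ := by
            linarith [ht.2, le_max_left x0.2 r, le_max_right x0.2 r]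
          rw [inv_mul_le_iff₀ (by positivity)]
          exact rpow_le_mul_rpow_of_comparable s ht0 (by linarith) h₁
  refine le_trans (le_of_eq ?_) (mul_le_mul_right hJ _)
  rw [← ENNReal.ofReal_mul (by positivity)]
  congr 1
  rw [div_eq_mul_inv r 2, mul_pow]
  ring

lemma lintegral_upperHalfBall_le_ofReal_mul (n : ℕ) {s : ℝ} (hs : -1 < s) {r : ℝ} (hr : 0 < r)
    (x0 : EuclideanSpace ℝ (Fin n) × ℝ) :
    ∫⁻ y in upperHalfBall n r x0, ENNReal.ofReal (y.2 ^ s) ≤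
      ENNReal.ofReal (((2 + 3 ^ (s + 1) / (s + 1)) * 4 ^ |s|) *
        (volume.real (Metric.ball (0 : EuclideanSpace ℝ (Fin n)) 1) * r ^ (n + 1)) *
        max x0.2 r ^ s) := by
  set ρ := max x0.2 r
  have hρ : 0 < ρ := lt_max_of_lt_right hr
  have hs1 : 0 < s + 1 := by linarith
  have hsub : upperHalfBall n r x0 ⊆
      Metric.ball x0.1 r ×ˢ Set.Ioo (max 0 (x0.2 - r)) (x0.2 + r) := by
    rintro ⟨a, t⟩ ⟨ht, h⟩
    dsimp only at ht h
    have h₁ : |t - x0.2| < r := abs_lt_of_sq_lt_sq (by nlinarith [sq_nonneg ‖a - x0.1‖]) hr.le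
    rw [abs_lt] at h₁
    refine ⟨?_, max_lt ht (by linarith), by dsimp only; linarith⟩
    rw [mem_ball_iff_norm]
    exact lt_of_pow_lt_pow_left₀ 2 hr.le (by nlinarith [sq_nonneg (t - x0.2)])
  refine (lintegral_mono_set hsub).trans ?_
  rw [lintegral_ball_prod_snd n x0.1 hr _ (f := fun t => ENNReal.ofReal (t ^ s)) (by fun_prop)]
  have hJ : ∫⁻ t in Set.Ioo (max 0 (x0.2 - r)) (x0.2 + r), ENNReal.ofReal (t ^ s) ≤
      ENNReal.ofReal ((2 + 3 ^ (s + 1) / (s + 1)) * 4 ^ |s| * ρ ^ s * r) := by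
    rcases le_total (2 * r) x0.2 with h | h
    · have hρx : ρ = x0.2 := max_eq_left (by linarith)
      calc _ ≤ ∫⁻ t in Set.Ioo (x0.2 - r) (x0.2 + r), ENNReal.ofReal (t ^ s) :=
            lintegral_mono_set (Set.Ioo_subset_Ioo_left (le_max_right _ _))
        _ ≤ ∫⁻ t in Set.Ioo (x0.2 - r) (x0.2 + r), ENNReal.ofReal (4 ^ |s| * ρ ^ s) := by
            refine setLIntegral_mono' measurableSet_Ioo fun t ht => ENNReal.ofReal_le_ofReal ?_
            exact rpow_le_mul_rpow_of_comparable s hρ (by linarith [ht.1]) (by linarith [ht.2])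
        _ = ENNReal.ofReal (2 * (4 ^ |s| * ρ ^ s * r)) := by
            rw [setLIntegral_const, Real.volume_Ioo, ← ENNReal.ofReal_mul (by positivity)]
            congr 1; ring
        _ ≤ _ := by
            refine ENNReal.ofReal_le_ofReal ?_
            have : 0 ≤ 3 ^ (s + 1) / (s + 1) * (4 ^ |s| * ρ ^ s * r) := by positivity
            linarith
    · have hρr : ρ ≤ 2 * r := max_le h (by linarith)
      have hrρ : r ≤ ρ := le_max_right _ _
      have hint : IntegrableOn (fun t : ℝ => t ^ s) (Set.Ioc 0 (3 * r)) :=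
        (intervalIntegrable_iff_integrableOn_Ioc_of_le (by positivity)).1
          (intervalIntegral.intervalIntegrable_rpow' hs)
      have hnn : 0 ≤ᵐ[volume.restrict (Set.Ioc 0 (3 * r))] fun t : ℝ => t ^ s :=
        (ae_restrict_iff' measurableSet_Ioc).2 (.of_forall fun t ht => Real.rpow_nonneg ht.1.le s)
      calc _ ≤ ∫⁻ t in Set.Ioc 0 (3 * r), ENNReal.ofReal (t ^ s) :=
            lintegral_mono_set fun t ht =>
              ⟨(le_max_left _ _).trans_lt ht.1, by linarith [ht.2]⟩
        _ = ENNReal.ofReal (3 ^ (s + 1) / (s + 1) * (r ^ s * r)) := by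
            rw [← ofReal_integral_eq_lintegral_ofReal hint hnn,
              ← intervalIntegral.integral_of_le (by positivity), integral_rpow (.inl hs),
              Real.zero_rpow hs1.ne', Real.mul_rpow (by norm_num) hr.le, Real.rpow_add_one hr.ne']
            congr 1; ring
        _ ≤ _ := by
            refine ENNReal.ofReal_le_ofReal ?_
            have h₁ := rpow_le_mul_rpow_of_comparable s hρ (y := r) (by linarith) (by linarith)
            calc 3 ^ (s + 1) / (s + 1) * (r ^ s * r)
                ≤ (2 + 3 ^ (s + 1) / (s + 1)) * ((4 ^ |s| * ρ ^ s) * r) := by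
                  gcongr; linarith
              _ = _ := by ring
  refine (mul_le_mul_right hJ _).trans (le_of_eq ?_)
  rw [← ENNReal.ofReal_mul (by positivity)]
  congr 1
  ring

lemma lintegral_upperHalfBall_pos (n : ℕ) (s : ℝ) {r : ℝ} (hr : 0 < r)
    (x0 : EuclideanSpace ℝ (Fin n) × ℝ) (hx : 0 ≤ x0.2) :
    0 < ∫⁻ y in upperHalfBall n r x0, ENNReal.ofReal (y.2 ^ s) := by
  refine lt_of_lt_of_le ?_ (ofReal_mul_le_lintegral_upperHalfBall n s hr x0 hx)
  have := volumeReal_unit_ball_pos n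
  have : 0 < max x0.2 r := lt_max_of_lt_right hr
  rw [ENNReal.ofReal_pos]
  positivity

lemma lintegral_upperHalfBall_ne_top (n : ℕ) {s : ℝ} (hs : -1 < s) {r : ℝ} (hr : 0 < r)
    (x0 : EuclideanSpace ℝ (Fin n) × ℝ) :
    ∫⁻ y in upperHalfBall n r x0, ENNReal.ofReal (y.2 ^ s) ≠ ⊤ :=
  ((lintegral_upperHalfBall_le_ofReal_mul n hs hr x0).trans_lt ENNReal.ofReal_lt_top).ne

lemma exists_lintegral_upperHalfBall_div_le (n : ℕ) {s γ : ℝ} (hs : -1 < s) :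
    ∃ K : ℝ, 0 < K ∧ ∀ r : ℝ, 0 < r → ∀ x0 : EuclideanSpace ℝ (Fin n) × ℝ, 0 ≤ x0.2 →
      (∫⁻ y in upperHalfBall n r x0, ENNReal.ofReal (y.2 ^ s)) /
        (∫⁻ y in upperHalfBall n r x0, ENNReal.ofReal (y.2 ^ γ)) ≤
      ENNReal.ofReal (K * max x0.2 r ^ (s - γ)) := by
  have hs1 : 0 < s + 1 := by linarith
  refine ⟨((2 + 3 ^ (s + 1) / (s + 1)) * 4 ^ |s|) / (2⁻¹ ^ n * 4⁻¹ * (4 ^ |γ|)⁻¹),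
    by positivity, fun r hr x0 hx => ?_⟩
  have hv := volumeReal_unit_ball_pos n
  have hρ : 0 < max x0.2 r := lt_max_of_lt_right hr
  refine (ENNReal.div_le_div (lintegral_upperHalfBall_le_ofReal_mul n hs hr x0)
    (ofReal_mul_le_lintegral_upperHalfBall n γ hr x0 hx)).trans (le_of_eq ?_)
  rw [← ENNReal.ofReal_div_of_pos (by positivity), Real.rpow_sub hρ]
  congr 1
  have := hv.ne'
  field_simp

lemma neg_one_lt_of_lintegral_upperHalfBall_ne_top (n : ℕ) {s : ℝ}
    (h : ∫⁻ y in upperHalfBall n 1 0, ENNReal.ofReal (y.2 ^ s) ≠ ⊤) : -1 < s := by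
  have hsub : Metric.ball (0 : EuclideanSpace ℝ (Fin n)) (1 / 2) ×ˢ Set.Ioo (0 : ℝ) (1 / 2) ⊆
      upperHalfBall n 1 0 := by
    rintro ⟨a, t⟩ ⟨ha, ht⟩
    simp only [mem_ball_zero_iff, Set.mem_Ioo] at ha ht
    refine ⟨ht.1, ?_⟩
    simp only [Prod.fst_zero, Prod.snd_zero, sub_zero]
    nlinarith [norm_nonneg a]
  have h' := ((lintegral_mono_set hsub).trans_lt h.lt_top)
  rw [lintegral_ball_prod_snd n 0 (by norm_num) _ (f := fun t => ENNReal.ofReal (t ^ s))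
    (by fun_prop)] at h'
  have hv := volumeReal_unit_ball_pos n
  have hc : ENNReal.ofReal ((1 / 2) ^ n *
      volume.real (Metric.ball (0 : EuclideanSpace ℝ (Fin n)) 1)) ≠ 0 :=
    (ENNReal.ofReal_pos.2 (by positivity)).ne'
  have hfin : ∫⁻ t in Set.Ioo (0 : ℝ) (1 / 2), ENNReal.ofReal (t ^ s) < ⊤ :=
    ENNReal.lt_top_of_mul_ne_top_right h'.ne hc
  rw [← intervalIntegral.integrableOn_Ioo_rpow_iff (t := 1 / 2) (by norm_num)]
  have hnn : 0 ≤ᵐ[volume.restrict (Set.Ioo (0 : ℝ) (1 / 2))] fun t : ℝ => t ^ s :=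
    (ae_restrict_iff' measurableSet_Ioo).2 (.of_forall fun t ht => Real.rpow_nonneg ht.1.le s)
  exact ⟨by fun_prop, (hasFiniteIntegral_iff_ofReal hnn).2 hfin⟩

/-- `x_d^β ∈ A_p(ℝ^d_+, μ_1)` with `μ_1 = x_d^{-α}dx` iff `β ∈ (α-1, (1-α)(p-1))`. -/
theorem stmt_6 (n : ℕ) (α p β : ℝ) (hα : α < 1) (hp : 1 < p) :
    (∃ C : ℝ≥0∞, C ≠ ⊤ ∧ ∀ r : ℝ, 0 < r →
      ∀ x0 : EuclideanSpace ℝ (Fin n) × ℝ, 0 ≤ x0.2 →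
        ((∫⁻ y in upperHalfBall n r x0, ENNReal.ofReal (y.2 ^ β * y.2 ^ (-α))) /
            (∫⁻ y in upperHalfBall n r x0, ENNReal.ofReal (y.2 ^ (-α)))) *
          (((∫⁻ y in upperHalfBall n r x0,
              ENNReal.ofReal ((y.2 ^ β) ^ (1 / (1 - p)) * y.2 ^ (-α))) /
            (∫⁻ y in upperHalfBall n r x0, ENNReal.ofReal (y.2 ^ (-α)))) ^ (p - 1)) ≤ C)
    ↔ (α - 1 < β ∧ β < (1 - α) * (p - 1)) := by
  have hint₁ : ∀ r (x0 : EuclideanSpace ℝ (Fin n) × ℝ),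
      ∫⁻ y in upperHalfBall n r x0, ENNReal.ofReal (y.2 ^ β * y.2 ^ (-α)) =
        ∫⁻ y in upperHalfBall n r x0, ENNReal.ofReal (y.2 ^ (β - α)) := fun r x0 =>
    setLIntegral_congr_fun (measurableSet_upperHalfBall n r x0) fun y hy => by
      rw [← Real.rpow_add hy.1, ← sub_eq_add_neg]
  have hint₂ : ∀ r (x0 : EuclideanSpace ℝ (Fin n) × ℝ),
      ∫⁻ y in upperHalfBall n r x0, ENNReal.ofReal ((y.2 ^ β) ^ (1 / (1 - p)) * y.2 ^ (-α)) =
        ∫⁻ y in upperHalfBall n r x0, ENNReal.ofReal (y.2 ^ (β * (1 / (1 - p)) - α)) :=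
    fun r x0 =>
    setLIntegral_congr_fun (measurableSet_upperHalfBall n r x0) fun y hy => by
      rw [← Real.rpow_mul hy.1.le, ← Real.rpow_add hy.1, ← sub_eq_add_neg]
  simp only [hint₁, hint₂]
  have hp1 : 0 < p - 1 := by linarith
  have hα' : -1 < -α := by linarith
  have hq : β * (1 / (1 - p)) = -(β / (p - 1)) := by
    rw [← neg_sub p 1]; field_simp
  have hβ : β < (1 - α) * (p - 1) ↔ -1 < β * (1 / (1 - p)) - α := by
    rw [hq, ← div_lt_iff₀ hp1]
    constructor <;> intro h <;> linarith
  rw [hβ]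
  constructor
  · rintro ⟨C, hC, h⟩
    have h0 := ((h 1 one_pos 0 le_rfl).trans_lt hC.lt_top).ne
    have hpos := fun s => lintegral_upperHalfBall_pos n s one_pos 0 le_rfl
    have hfin := lintegral_upperHalfBall_ne_top n hα' one_pos 0
    have hdiv := fun s => (ENNReal.div_pos (hpos s).ne' hfin).ne'
    constructor
    · suffices -1 < β - α by linarith
      apply neg_one_lt_of_lintegral_upperHalfBall_ne_top n
      intro htop
      have h₁ := ENNReal.lt_top_of_mul_ne_top_left h0
        (fun h' => hdiv _ ((ENNReal.rpow_eq_zero_iff_of_pos hp1).1 h'))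
      rw [htop, ENNReal.top_div_of_ne_top hfin] at h₁
      exact lt_irrefl _ h₁
    · apply neg_one_lt_of_lintegral_upperHalfBall_ne_top n
      intro htop
      have h₁ := ENNReal.lt_top_of_mul_ne_top_right h0 (hdiv _)
      rw [htop, ENNReal.top_div_of_ne_top hfin, ENNReal.top_rpow_of_pos hp1] at h₁
      exact lt_irrefl _ h₁
  · rintro ⟨h₁, h₂⟩
    obtain ⟨K, hK, hKle⟩ := exists_lintegral_upperHalfBall_div_le n (s := β - α) (γ := -α)
      (by linarith)
    obtain ⟨L, hL, hLle⟩ := exists_lintegral_upperHalfBall_div_le n (γ := -α) h₂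
    refine ⟨ENNReal.ofReal (K * L ^ (p - 1)), ENNReal.ofReal_ne_top, fun r hr x0 hx => ?_⟩
    have hρ : 0 < max x0.2 r := lt_max_of_lt_right hr
    refine (mul_le_mul' (hKle r hr x0 hx)
      (ENNReal.rpow_le_rpow (hLle r hr x0 hx) hp1.le)).trans (le_of_eq ?_)
    rw [ENNReal.ofReal_rpow_of_pos (by positivity), ← ENNReal.ofReal_mul (by positivity),
      Real.mul_rpow hL.le (by positivity), ← Real.rpow_mul hρ.le]
    have he : (β * (1 / (1 - p)) - α - -α) * (p - 1) = -(β - α - -α) := by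
      rw [hq]; field_simp; ring
    rw [he, Real.rpow_neg hρ.le]
    congr 1
    have := (Real.rpow_pos_of_pos hρ (β - α - -α)).ne'
    field_simp
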